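/- Let α > 0, c₀, γ ∈ ℝ, λ = −γ/α², k = (c₀ + γ/α²)/2, and T ∈ (0, ∞]. Let u : [0,T) × ℝ → ℝ be twice continuously differentiable such that for every t ∈ [0,T): u(t,·) and ∂ₓu(t,·) are square-integrable on ℝ and u(t,y) → 0 as |y| → ∞, and such that u satisfies pointwise the nonlocal Dullin–Gottwald–Holm equation ∂ₜu + (u + λ)∂ₓu = −∂ₓ[p ∗ ((α²/2)(∂ₓu)² + u² + 2ku)], where the convolution is in the space variable. Let q : [0,T) × ℝ → ℝ be continuously differentiable with q(0,x) = x and ∂ₜq(t,x) = u(t,q(t,x)) + λ for all (t,x). If there exists x₀ ∈ ℝ such that ∂ₓu(0,x₀) < −(1/α)|u(0,x₀) + k|, then T ≤ 2/√(∂ₓu(0,x₀)² − (u(0,x₀)+k)²/α²); in particular T < ∞. -/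

import Mathlib

open MeasureTheory Filter
open Set Topology

/-- A pair of functions satisfying the coupled Riccati inequalities `A', B' ≥ c A B` with positive
initial data cannot exist beyond time `1 / (c √(A(0) B(0)))`. -/
theorem riccati_pair_lifespan_le {c S : ℝ} (hc : 0 < c) (hS : 0 < S) {A B A' B' : ℝ → ℝ}
    (hA : ContinuousOn A (Icc 0 S)) (hB : ContinuousOn B (Icc 0 S))
    (hA' : ∀ t ∈ Ioo 0 S, HasDerivAt A (A' t) t) (hB' : ∀ t ∈ Ioo 0 S, HasDerivAt B (B' t) t)
    (hAle : ∀ t ∈ Ioo 0 S, c * (A t * B t) ≤ A' t) (hBle : ∀ t ∈ Ioo 0 S, c * (A t * B t) ≤ B' t)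
    (hA0 : 0 < A 0) (hB0 : 0 < B 0) : S ≤ 1 / (c * √(A 0 * B 0)) := by
  have hpos : ∀ t ∈ Icc 0 S, 0 < A t ∧ 0 < B t := by
    by_contra! hcon
    obtain ⟨t₁, ht₁, hbad₁⟩ := hcon
    let Z := Icc (0 : ℝ) S ∩ (fun t => min (A t) (B t)) ⁻¹' Iic 0
    have hZ : IsCompact Z :=
      isCompact_Icc.of_isClosed_subset
        ((hA.inf hB).preimage_isClosed_of_isClosed isClosed_Icc isClosed_Iic) inter_subset_left
    have hZne : Z.Nonempty := by
      refine ⟨t₁, ht₁, ?_⟩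
      by_cases h : 0 < A t₁
      · exact min_le_of_right_le (hbad₁ h)
      · exact min_le_of_left_le (not_lt.mp h)
    obtain ⟨τ, ⟨hτS, hτ⟩, hmin⟩ := hZ.exists_isLeast hZne
    have hsub : Icc 0 τ ⊆ Icc 0 S := Icc_subset_Icc_right hτS.2
    have hpre : ∀ t ∈ Ioo 0 τ, t ∈ Ioo 0 S ∧ 0 < A t * B t := by
      intro t ht
      have htS : t ∈ Ioo 0 S := ⟨ht.1, ht.2.trans_le hτS.2⟩
      have hnot : ¬ min (A t) (B t) ≤ 0 := fun h =>
        absurd (hmin ⟨Ioo_subset_Icc_self htS, h⟩) (not_le.mpr ht.2)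
      have := lt_min_iff.mp (not_le.mp hnot)
      exact ⟨htS, mul_pos this.1 this.2⟩
    have hmono : ∀ {f f' : ℝ → ℝ}, ContinuousOn f (Icc 0 S) →
        (∀ t ∈ Ioo 0 S, HasDerivAt f (f' t) t) → (∀ t ∈ Ioo 0 S, c * (A t * B t) ≤ f' t) →
        f 0 ≤ f τ := by
      intro f f' hf hf' hfle
      refine monotoneOn_of_hasDerivWithinAt_nonneg (f' := f') (convex_Icc 0 τ) (hf.mono hsub)
        (fun t ht => ?_) (fun t ht => ?_)
        (left_mem_Icc.mpr hτS.1) (right_mem_Icc.mpr hτS.1) hτS.1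
      · rw [interior_Icc] at ht
        exact (hf' t (hpre t ht).1).hasDerivWithinAt
      · rw [interior_Icc] at ht
        exact (mul_pos hc (hpre t ht).2).le.trans (hfle t (hpre t ht).1)
    have hτpos : 0 < min (A τ) (B τ) :=
      lt_min (hA0.trans_le (hmono hA hA' hAle)) (hB0.trans_le (hmono hB hB' hBle))
    exact absurd hτ (not_le.mpr hτpos)
  have hanti : AntitoneOn (fun t => (√(A t * B t))⁻¹ + c * t) (Icc 0 S) := by
    refine antitoneOn_of_hasDerivWithinAt_nonpos (convex_Icc 0 S)
      (f' := fun t => -((A' t * B t + A t * B' t) / (2 * √(A t * B t))) / √(A t * B t) ^ 2 + c)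
      ?_ (fun t ht => ?_) (fun t ht => ?_)
    · exact ((hA.mul hB).sqrt.inv₀ fun t ht =>
        (Real.sqrt_pos.mpr (mul_pos (hpos t ht).1 (hpos t ht).2)).ne').add (by fun_prop)
    · rw [interior_Icc] at ht
      obtain ⟨hAt, hBt⟩ := hpos t (Ioo_subset_Icc_self ht)
      have hAB := mul_pos hAt hBt
      have h := (((hA' t ht).mul (hB' t ht)).sqrt hAB.ne').inv (Real.sqrt_pos.mpr hAB).ne'
      have h2 : HasDerivAt (fun t : ℝ => c * t) c t := by
        simpa using (hasDerivAt_id t).const_mul c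
      exact (h.add h2).hasDerivWithinAt
    · rw [interior_Icc] at ht
      obtain ⟨hAt, hBt⟩ := hpos t (Ioo_subset_Icc_self ht)
      have hAB := mul_pos hAt hBt
      set h := √(A t * B t) with hh
      have hpos' : 0 < h := Real.sqrt_pos.mpr hAB
      have hsq : h ^ 2 = A t * B t := Real.sq_sqrt hAB.le
      have hamgm : 2 * h ≤ A t + B t := by
        apply abs_le_of_sq_le_sq' _ (by positivity) |>.2
        nlinarith [sq_nonneg (A t - B t)]
      have hkey : 2 * c * h ^ 3 ≤ A' t * B t + A t * B' t := by
        have h1 := mul_le_mul_of_nonneg_right (hAle t ht) hBt.le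
        have h2 := mul_le_mul_of_nonneg_left (hBle t ht) hAt.le
        have h3 := mul_le_mul_of_nonneg_left hamgm (mul_pos hc hAB).le
        have h4 : 2 * c * h ^ 3 = c * (A t * B t) * (2 * h) := by rw [← hsq]; ring
        nlinarith
      have : -((A' t * B t + A t * B' t) / (2 * h)) / h ^ 2 + c
          = -(A' t * B t + A t * B' t - 2 * c * h ^ 3) / (2 * h ^ 3) := by
        field_simp
        ring
      rw [this]
      exact div_nonpos_of_nonpos_of_nonneg (by linarith) (by positivity)
  have h := hanti (left_mem_Icc.mpr hS.le) (right_mem_Icc.mpr hS.le) hS.le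
  have hSpos : 0 < (√(A S * B S))⁻¹ := by
    have := hpos S (right_mem_Icc.mpr hS.le)
    exact inv_pos.mpr (Real.sqrt_pos.mpr (mul_pos this.1 this.2))
  have h0 : 0 < √(A 0 * B 0) := Real.sqrt_pos.mpr (mul_pos hA0 hB0)
  have h1 : c * S ≤ (√(A 0 * B 0))⁻¹ := by
    simp only [mul_zero, add_zero] at h
    linarith
  rw [le_div_iff₀ (mul_pos hc h0)]
  calc S * (c * √(A 0 * B 0)) = c * S * √(A 0 * B 0) := by ring
    _ ≤ (√(A 0 * B 0))⁻¹ * √(A 0 * B 0) := by gcongr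
    _ = 1 := inv_mul_cancel₀ h0.ne'

/-- A `C²` function of two variables with partial derivatives `ut`, `ux` has symmetric mixed
derivatives, and `ux` obeys the chain rule along curves `s ↦ (s, r s)`. -/
theorem hasDerivAt_partial_along_curve {Ω : Set (ℝ × ℝ)} (hΩ : IsOpen Ω) {u ut ux : ℝ → ℝ → ℝ}
    (hu : ContDiffOn ℝ 2 (fun p : ℝ × ℝ => u p.1 p.2) Ω)
    (hut : ∀ p ∈ Ω, HasDerivAt (fun s => u s p.2) (ut p.1 p.2) p.1)
    (hux : ∀ p ∈ Ω, HasDerivAt (u p.1) (ux p.1 p.2) p.2) {t x : ℝ} (hp : (t, x) ∈ Ω) :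
    ∃ a b : ℝ, HasDerivAt (ux t) a x ∧ HasDerivAt (ut t) b x ∧
      ∀ (r : ℝ → ℝ) (r' : ℝ), r t = x → HasDerivAt r r' t →
        HasDerivAt (fun s => ux s (r s)) (b + r' * a) t := by
  set U : ℝ × ℝ → ℝ := fun p => u p.1 p.2 with hU
  set D := fderiv ℝ U with hD
  have hUd : ∀ p ∈ Ω, HasFDerivAt U (D p) p := fun p hp =>
    ((hu.contDiffAt (hΩ.mem_nhds hp)).differentiableAt (by norm_num)).hasFDerivAt
  have hDt : ∀ p ∈ Ω, ut p.1 p.2 = D p (1, 0) := fun p hp =>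
    (hut p hp).unique <| HasFDerivAt.comp_hasDerivAt p.1 (f := fun s => (s, p.2)) (hUd p hp)
      ((hasDerivAt_id p.1).prodMk (hasDerivAt_const p.1 p.2))
  have hDx : ∀ p ∈ Ω, ux p.1 p.2 = D p (0, 1) := fun p hp =>
    (hux p hp).unique <| HasFDerivAt.comp_hasDerivAt p.2 (f := fun y => (p.1, y)) (hUd p hp)
      ((hasDerivAt_const p.2 p.1).prodMk (hasDerivAt_id p.2))
  have hc := hu.contDiffAt (hΩ.mem_nhds hp)
  have hDD : HasFDerivAt D (fderiv ℝ D (t, x)) (t, x) :=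
    ((hc.fderiv_right (m := 1) (by norm_num)).differentiableAt (by norm_num)).hasFDerivAt
  set D₂ := fderiv ℝ D (t, x) with hD₂
  have hsymm : D₂ (1, 0) (0, 1) = D₂ (0, 1) (1, 0) :=
    (hc.isSymmSndFDerivAt (by simp)) (1, 0) (0, 1)
  have hline : HasDerivAt (fun y : ℝ => (t, y)) ((0 : ℝ), (1 : ℝ)) x :=
    (hasDerivAt_const x t).prodMk (hasDerivAt_id x)
  have hmem : ∀ᶠ y in 𝓝 x, (t, y) ∈ Ω :=
    hline.continuousAt.eventually (hΩ.mem_nhds hp)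
  have hDline : HasDerivAt (fun y => D (t, y)) (D₂ (0, 1)) x := hDD.comp_hasDerivAt x hline
  refine ⟨D₂ (0, 1) (0, 1), D₂ (0, 1) (1, 0), ?_, ?_, ?_⟩
  · refine HasDerivAt.congr_of_eventuallyEq ?_ (hmem.mono fun y hy => hDx _ hy)
    simpa using hDline.clm_apply (hasDerivAt_const x ((0 : ℝ), (1 : ℝ)))
  · refine HasDerivAt.congr_of_eventuallyEq ?_ (hmem.mono fun y hy => hDt _ hy)
    simpa using hDline.clm_apply (hasDerivAt_const x ((1 : ℝ), (0 : ℝ)))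
  · rintro r r' rfl hr
    have hcurve : HasDerivAt (fun s => (s, r s)) (1, r') t := (hasDerivAt_id t).prodMk hr
    have hmem' : ∀ᶠ s in 𝓝 t, (s, r s) ∈ Ω := hcurve.continuousAt.eventually (hΩ.mem_nhds hp)
    refine HasDerivAt.congr_of_eventuallyEq ?_ (hmem'.mono fun s hs => hDx _ hs)
    have h : HasDerivAt (fun s => D (s, r s) (0, 1)) _ t :=
      (HasFDerivAt.comp_hasDerivAt t (f := fun s => (s, r s)) hDD hcurve).clm_apply
      (hasDerivAt_const t ((0 : ℝ), (1 : ℝ)))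
    have hv : ((1 : ℝ), r') = (1, 0) + r' • (0, 1) := by simp
    refine h.congr_deriv ?_
    rw [hv, map_add, map_smul]
    simp [hsymm]

/-- The left half `(1/(2α)) ∫_{-∞}^x e^{(y-x)/α} f(y) dy` of the convolution of `f` with the Green
function of `1 - α²∂ₓ²`. -/
noncomputable def leftGreen (α : ℝ) (f : ℝ → ℝ) (x : ℝ) : ℝ :=
  1 / (2 * α) * (Real.exp (-x / α) * ∫ y in Iic x, Real.exp (y / α) * f y)

theorem hasDerivAt_integral_Iic {g : ℝ → ℝ} (hg : Continuous g)
    (hint : ∀ x, IntegrableOn g (Iic x)) (x : ℝ) :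
    HasDerivAt (fun x => ∫ y in Iic x, g y) (g x) x := by
  have h : (fun x => ∫ y in Iic x, g y) = fun x => (∫ y in Iic 0, g y) + ∫ y in (0 : ℝ)..x, g y := by
    ext x
    rw [← intervalIntegral.integral_Iic_sub_Iic (hint 0) (hint x)]
    ring
  rw [h]
  exact (intervalIntegral.integral_hasDerivAt_right (hg.intervalIntegrable _ _)
    hg.aestronglyMeasurable.stronglyMeasurableAtFilter hg.continuousAt).const_add _

theorem tendsto_integral_Iic_atBot {g : ℝ → ℝ} (hint : ∀ x, IntegrableOn g (Iic x)) :
    Tendsto (fun x => ∫ y in Iic x, g y) atBot (𝓝 0) := by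
  have h := (intervalIntegral_tendsto_integral_Iic 0 (hint 0) tendsto_id).const_sub
    (∫ y in Iic 0, g y)
  rw [sub_self] at h
  refine h.congr fun x => ?_
  rw [id, ← intervalIntegral.integral_Iic_sub_Iic (hint x) (hint 0)]
  ring

theorem hasDerivAt_exp_div (α x : ℝ) :
    HasDerivAt (fun y => Real.exp (y / α)) (Real.exp (x / α) / α) x := by
  simpa [div_eq_mul_inv] using ((hasDerivAt_id x).div_const α).exp

theorem exp_neg_div_mul_exp_div (α x : ℝ) : Real.exp (-x / α) * Real.exp (x / α) = 1 := by
  rw [← Real.exp_add, ← add_div, neg_add_cancel, zero_div, Real.exp_zero]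

theorem hasDerivAt_leftGreen (α : ℝ) {f : ℝ → ℝ} (hf : Continuous f)
    (hint : ∀ x, IntegrableOn (fun y => Real.exp (y / α) * f y) (Iic x)) (x : ℝ) :
    HasDerivAt (leftGreen α f) (-leftGreen α f x / α + f x / (2 * α)) x := by
  have hexp : HasDerivAt (fun y => Real.exp (-y / α)) (-(Real.exp (-x / α) / α)) x := by
    have h := (hasDerivAt_exp_div α (-x)).comp x (hasDerivAt_neg x)
    exact h.congr_deriv (mul_neg_one _)
  have h := ((hexp.mul (hasDerivAt_integral_Iic (by fun_prop) hint x)).const_mul (1 / (2 * α)))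
  refine h.congr_deriv ?_
  unfold leftGreen
  linear_combination (f x / (2 * α)) * exp_neg_div_mul_exp_div α x

theorem integrableOn_exp_mul_energy {α : ℝ} (hα : 0 < α) (k : ℝ) {u ux : ℝ → ℝ}
    (hu : Continuous u) (hux : Continuous ux) (hu2 : Integrable fun y => u y ^ 2)
    (hux2 : Integrable fun y => ux y ^ 2) (x : ℝ) :
    IntegrableOn (fun y => Real.exp (y / α) *
      (α ^ 2 / 2 * ux y ^ 2 + u y ^ 2 + 2 * k * u y)) (Iic x) := by
  have hexp : IntegrableOn (fun y => Real.exp (y / α)) (Iic x) := by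
    simpa [div_eq_inv_mul] using integrableOn_exp_mul_Iic (inv_pos.mpr hα) x
  have hdom : IntegrableOn (fun y => Real.exp (x / α) *
      (α ^ 2 / 2 * ux y ^ 2 + (1 + |k|) * u y ^ 2) + |k| * Real.exp (y / α)) (Iic x) :=
    (((hux2.const_mul _).add (hu2.const_mul _)).const_mul _).integrableOn.add (hexp.const_mul _)
  refine hdom.mono' (by fun_prop) ((ae_restrict_mem measurableSet_Iic).mono fun y hy => ?_)
  have hle : Real.exp (y / α) ≤ Real.exp (x / α) :=
    Real.exp_le_exp.mpr (div_le_div_of_nonneg_right hy hα.le)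
  have hu1 : 2 * |u y| ≤ 1 + u y ^ 2 := by
    rw [← sq_abs]; nlinarith [sq_nonneg (|u y| - 1)]
  have hF : |α ^ 2 / 2 * ux y ^ 2 + u y ^ 2 + 2 * k * u y|
      ≤ (α ^ 2 / 2 * ux y ^ 2 + (1 + |k|) * u y ^ 2) + |k| := by
    refine (abs_add_le _ _).trans ?_
    rw [abs_of_nonneg (by positivity : 0 ≤ α ^ 2 / 2 * ux y ^ 2 + u y ^ 2), abs_mul, abs_mul, abs_two]
    nlinarith [mul_le_mul_of_nonneg_left hu1 (abs_nonneg k)]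
  rw [Real.norm_eq_abs, abs_mul, Real.abs_exp]
  calc _ ≤ Real.exp (y / α) * ((α ^ 2 / 2 * ux y ^ 2 + (1 + |k|) * u y ^ 2) + |k|) := by gcongr
    _ = Real.exp (y / α) * (α ^ 2 / 2 * ux y ^ 2 + (1 + |k|) * u y ^ 2)
        + |k| * Real.exp (y / α) := by ring
    _ ≤ _ := by gcongr

/-- The left half of `p ∗ ((α²/2)uₓ² + u² + 2ku)` dominates `(u+k)²/4 - k²/2`: after multiplication
by `e^{x/α}` the difference is nondecreasing and vanishes at `-∞`. -/
theorem leftGreen_energy_ge {α : ℝ} (hα : 0 < α) (k : ℝ) {u ux : ℝ → ℝ}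
    (hu : ∀ x, HasDerivAt u (ux x) x) (hux : Continuous ux) (hu2 : Integrable fun y => u y ^ 2)
    (hux2 : Integrable fun y => ux y ^ 2) (hbot : Tendsto u atBot (𝓝 0)) (x : ℝ) :
    (u x + k) ^ 2 / 4 - k ^ 2 / 2
      ≤ leftGreen α (fun y => α ^ 2 / 2 * ux y ^ 2 + u y ^ 2 + 2 * k * u y) x := by
  have huc : Continuous u := continuous_iff_continuousAt.mpr fun x => (hu x).continuousAt
  have hint := integrableOn_exp_mul_energy hα k huc hux hu2 hux2
  set F : ℝ → ℝ := fun y => α ^ 2 / 2 * ux y ^ 2 + u y ^ 2 + 2 * k * u y with hF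
  let J : ℝ → ℝ := fun x => 1 / (2 * α) * (∫ y in Iic x, Real.exp (y / α) * F y)
    + Real.exp (x / α) * (k ^ 2 / 2 - (u x + k) ^ 2 / 4)
  have hJ' : ∀ x, HasDerivAt J (Real.exp (x / α) * ((α * ux x - (u x + k)) ^ 2 / (4 * α))) x := by
    intro x
    have h := ((hasDerivAt_integral_Iic (by fun_prop) hint x).const_mul (1 / (2 * α))).add
      ((hasDerivAt_exp_div α x).mul
        (((((hu x).add_const k).pow 2).div_const 4).const_sub (k ^ 2 / 2)))
    refine h.congr_deriv ?_
    norm_num [hF]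
    field_simp
    ring
  have hmono : Monotone J :=
    monotone_of_hasDerivAt_nonneg hJ' fun x => by positivity
  have hlim : Tendsto J atBot (𝓝 0) := by
    have hexp : Tendsto (fun x => Real.exp (x / α)) atBot (𝓝 0) :=
      Real.tendsto_exp_atBot.comp (tendsto_id.atBot_div_const hα)
    have h := ((tendsto_integral_Iic_atBot hint).const_mul (1 / (2 * α))).add
      (hexp.mul ((((hbot.add_const k).pow 2).div_const 4).const_sub (k ^ 2 / 2)))
    simpa [J, hF] using h
  have hJ : 0 ≤ J x := hmono.le_of_tendsto hlim x
  have h := mul_nonneg (Real.exp_pos (-x / α)).le hJ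
  have heq : Real.exp (-x / α) * J x
      = leftGreen α F x + (k ^ 2 / 2 - (u x + k) ^ 2 / 4) := by
    simp only [J, leftGreen]
    linear_combination (k ^ 2 / 2 - (u x + k) ^ 2 / 4) * exp_neg_div_mul_exp_div α x
  linarith

/-- Convolution with the Green function is the sum of its left half and its right half, the latter
being the left half of the reflected function. -/
theorem integral_green_mul_eq (α : ℝ) (f : ℝ → ℝ)
    (hl : ∀ x, IntegrableOn (fun y => Real.exp (y / α) * f y) (Iic x))
    (hr : ∀ x, IntegrableOn (fun y => Real.exp (y / α) * f (-y)) (Iic x)) (z : ℝ) :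
    ∫ y, 1 / (2 * α) * Real.exp (-|z - y| / α) * f y
      = leftGreen α f z + leftGreen α (fun y => f (-y)) (-z) := by
  have hleft : EqOn (fun y => 1 / (2 * α) * Real.exp (-|z - y| / α) * f y)
      (fun y => 1 / (2 * α) * (Real.exp (-z / α) * (Real.exp (y / α) * f y))) (Iic z) := by
    intro y hy
    have : -|z - y| / α = -z / α + y / α := by
      rw [abs_of_nonneg (sub_nonneg.mpr hy)]; ring
    simp only [this, Real.exp_add]
    ring
  have hright : EqOn (fun y => 1 / (2 * α) * Real.exp (-|z - -y| / α) * f (-y))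
      (fun y => 1 / (2 * α) * (Real.exp (-(-z) / α) * (Real.exp (y / α) * f (-y))))
      (Iic (-z)) := by
    intro y hy
    have : -|z - -y| / α = -(-z) / α + y / α := by
      rw [abs_of_nonpos (by have : y ≤ -z := hy; linarith)]; ring
    simp only [this, Real.exp_add]
    ring
  have hil := (integrableOn_congr_fun hleft measurableSet_Iic).mpr
    (((hl z).const_mul _).const_mul _)
  have hir : IntegrableOn (fun y => 1 / (2 * α) * Real.exp (-|z - y| / α) * f y) (Ioi z) := by
    have h := ((integrableOn_congr_fun hright measurableSet_Iic).mpr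
      (((hr (-z)).const_mul _).const_mul _)).comp_neg_Ici
    simpa using (Iff.mp integrableOn_Ici_iff_integrableOn_Ioi h)
  rw [← intervalIntegral.integral_Iic_add_Ioi hil hir, setIntegral_congr_fun measurableSet_Iic hleft]
  have hneg := integral_comp_neg_Iic (-z)
    (fun y => 1 / (2 * α) * Real.exp (-|z - y| / α) * f y)
  rw [neg_neg, setIntegral_congr_fun measurableSet_Iic hright] at hneg
  rw [← hneg]
  simp only [integral_const_mul, leftGreen]

/-- For fixed time, the nonlocal term `p ∗ ((α²/2)uₓ² + u² + 2ku)` splits into two halves `L` and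
`R` solving first-order linear equations and bounded below by a local expression. -/
theorem exists_green_halves {α : ℝ} (hα : 0 < α) (k : ℝ) {u ux : ℝ → ℝ}
    (hu : ∀ x, HasDerivAt u (ux x) x) (hux : Continuous ux) (hu2 : Integrable fun y => u y ^ 2)
    (hux2 : Integrable fun y => ux y ^ 2)
    (htop : Tendsto u atTop (𝓝 0)) (hbot : Tendsto u atBot (𝓝 0)) :
    ∃ L R : ℝ → ℝ,
      (∀ x, HasDerivAt L
        (-L x / α + (α ^ 2 / 2 * ux x ^ 2 + u x ^ 2 + 2 * k * u x) / (2 * α)) x) ∧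
      (∀ x, HasDerivAt R
        (R x / α - (α ^ 2 / 2 * ux x ^ 2 + u x ^ 2 + 2 * k * u x) / (2 * α)) x) ∧
      (∀ x, (u x + k) ^ 2 / 4 - k ^ 2 / 2 ≤ L x) ∧
      (∀ x, (u x + k) ^ 2 / 4 - k ^ 2 / 2 ≤ R x) ∧
      ∀ x, deriv (fun z => ∫ y : ℝ, 1 / (2 * α) * Real.exp (-|z - y| / α) *
        (α ^ 2 / 2 * ux y ^ 2 + u y ^ 2 + 2 * k * u y)) x = (R x - L x) / α := by
  have huc : Continuous u := continuous_iff_continuousAt.mpr fun x => (hu x).continuousAt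
  have hl := integrableOn_exp_mul_energy hα k huc hux hu2 hux2
  have hv : ∀ x, HasDerivAt (fun y => u (-y)) (-ux (-x)) x := fun x =>
    ((hu (-x)).comp x (hasDerivAt_neg x)).congr_deriv (mul_neg_one _)
  have hr := integrableOn_exp_mul_energy hα k (u := fun y => u (-y)) (ux := fun y => -ux (-y))
    (by fun_prop) (by fun_prop) hu2.comp_neg (by simpa using hux2.comp_neg)
  have hR := leftGreen_energy_ge hα k hv (by fun_prop) hu2.comp_neg (by simpa using hux2.comp_neg)
    (htop.comp tendsto_neg_atBot_atTop)
  simp only [neg_sq] at hr hR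
  set F : ℝ → ℝ := fun y => α ^ 2 / 2 * ux y ^ 2 + u y ^ 2 + 2 * k * u y with hF
  have hL' := hasDerivAt_leftGreen α (f := F) (by fun_prop) hl
  have hR' : ∀ x, HasDerivAt (fun z => leftGreen α (fun y => F (-y)) (-z))
      (leftGreen α (fun y => F (-y)) (-x) / α - F x / (2 * α)) x := by
    intro x
    refine ((hasDerivAt_leftGreen α (f := fun y => F (-y)) (by fun_prop) hr (-x)).comp x
      (hasDerivAt_neg x)).congr_deriv ?_
    rw [neg_neg]
    ring
  refine ⟨leftGreen α F, fun z => leftGreen α (fun y => F (-y)) (-z), hL', hR',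
    leftGreen_energy_ge hα k hu hux hu2 hux2 hbot, fun x => by simpa using hR (-x), fun x => ?_⟩
  have hconv : (fun z => ∫ y : ℝ, 1 / (2 * α) * Real.exp (-|z - y| / α) * F y)
      = fun z => leftGreen α F z + leftGreen α (fun y => F (-y)) (-z) :=
    funext fun z => integral_green_mul_eq α F hl hr z
  rw [hconv]
  refine ((hL' x).add (hR' x)).deriv.trans ?_
  ring

/-- On a half-open time strip, including its initial time, the partial derivative `ux` of a `C²`
function is jointly continuous. -/
theorem continuousOn_partial_of_contDiffOn {I : Set ℝ} (hI : I.OrdConnected)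
    (hIne : (interior I).Nonempty) {u ux : ℝ → ℝ → ℝ}
    (hu : ContDiffOn ℝ 2 (fun p : ℝ × ℝ => u p.1 p.2) (I ×ˢ univ))
    (hux : ∀ t ∈ I, ∀ x, HasDerivAt (u t) (ux t x) x) :
    ContinuousOn (fun p : ℝ × ℝ => ux p.1 p.2) (I ×ˢ univ) := by
  have hconv : Convex ℝ (I ×ˢ (univ : Set ℝ)) := hI.convex.prod convex_univ
  have huniq : UniqueDiffOn ℝ (I ×ˢ (univ : Set ℝ)) :=
    uniqueDiffOn_convex hconv (by rw [interior_prod_eq]; exact hIne.prod (by simp))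
  refine ((hu.continuousOn_fderivWithin huniq (by norm_num)).clm_apply
    (continuousOn_const (c := ((0 : ℝ), (1 : ℝ))))).congr fun p hp => ?_
  have hd : HasFDerivWithinAt (fun p : ℝ × ℝ => u p.1 p.2) _ (I ×ˢ univ) (p.1, p.2) :=
    ((hu p hp).differentiableWithinAt (by norm_num)).hasFDerivWithinAt
  have hline : HasDerivAt (fun y : ℝ => (p.1, y)) ((0 : ℝ), (1 : ℝ)) p.2 :=
    (hasDerivAt_const p.2 p.1).prodMk (hasDerivAt_id p.2)
  have h := hd.comp_hasDerivAt p.2 (f := fun y : ℝ => (p.1, y)) hline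
    (Eventually.of_forall fun y => ⟨hp.1, mem_univ y⟩)
  exact (hux p.1 hp.1 p.2).unique h

/-- Local-in-space blow-up criterion for the Dullin–Gottwald–Holm equation
(Theorem 1.1, with the explicit bound of the Appendix): if `u` is a `C²`
solution of `uₜ + (u+λ)uₓ = -∂ₓ[p ∗ ((α²/2)uₓ² + u² + 2ku)]` on `[0,T) × ℝ`,
square-integrable together with `uₓ` and vanishing at infinity, `q` its
particle trajectory, and if at some point `x₀` one has
`u₀′(x₀) < -(1/α)|u₀(x₀) + k|`, then
`T ≤ 2/√(u₀′(x₀)² - (u₀(x₀)+k)²/α²)`; in particular `T < ∞`. -/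
theorem dgh_local_blowup_criterion
    (α c₀ γ lam k : ℝ) (hα : 0 < α)
    (hlam : lam = -γ / α ^ 2) (hk : k = (c₀ + γ / α ^ 2) / 2)
    (T : EReal) (hT : (0 : EReal) < T)
    (u ut ux : ℝ → ℝ → ℝ)
    (huC2 : ContDiffOn ℝ 2 (fun p : ℝ × ℝ => u p.1 p.2)
      {p : ℝ × ℝ | 0 ≤ p.1 ∧ (p.1 : EReal) < T})
    (hut : ∀ t x : ℝ, 0 ≤ t → (t : EReal) < T →
      HasDerivAt (fun s => u s x) (ut t x) t)
    (hux : ∀ t x : ℝ, 0 ≤ t → (t : EReal) < T →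
      HasDerivAt (fun y => u t y) (ux t x) x)
    (hL2 : ∀ t : ℝ, 0 ≤ t → (t : EReal) < T →
      Integrable (fun y => (u t y) ^ 2) ∧ Integrable (fun y => (ux t y) ^ 2))
    (hdecay : ∀ t : ℝ, 0 ≤ t → (t : EReal) < T →
      Tendsto (fun y => u t y) atTop (nhds 0) ∧
      Tendsto (fun y => u t y) atBot (nhds 0))
    -- the DGH equation in nonlocal form, the convolution being in space
    (hPDE : ∀ t x : ℝ, 0 ≤ t → (t : EReal) < T →
      ut t x + (u t x + lam) * ux t x
        = - deriv (fun z => ∫ y : ℝ, (1 / (2 * α)) * Real.exp (-|z - y| / α) *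
            ((α ^ 2 / 2) * (ux t y) ^ 2 + (u t y) ^ 2 + 2 * k * u t y)) x)
    (q : ℝ → ℝ → ℝ)
    (hqC1 : ContDiffOn ℝ 1 (fun p : ℝ × ℝ => q p.1 p.2)
      {p : ℝ × ℝ | 0 ≤ p.1 ∧ (p.1 : EReal) < T})
    (hq0 : ∀ x, q 0 x = x)
    (hqt : ∀ t x : ℝ, 0 ≤ t → (t : EReal) < T →
      HasDerivAt (fun s => q s x) (u t (q t x) + lam) t)
    (x₀ : ℝ)
    (hx₀ : ux 0 x₀ < -(1 / α) * |u 0 x₀ + k|) :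
    T ≤ ((2 / Real.sqrt ((ux 0 x₀) ^ 2 - (u 0 x₀ + k) ^ 2 / α ^ 2) : ℝ) : EReal)
      ∧ T < ⊤ := by
  have hS : ∀ S : ℝ, 0 < S → (S : EReal) < T →
      S ≤ 2 / √(ux 0 x₀ ^ 2 - (u 0 x₀ + k) ^ 2 / α ^ 2) := by
    intro S hS0 hST
    set I : Set ℝ := {t | 0 ≤ t ∧ (t : EReal) < T} with hI
    have hIprod : {p : ℝ × ℝ | 0 ≤ p.1 ∧ (p.1 : EReal) < T} = I ×ˢ univ := by
      ext p; simp [hI]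
    rw [hIprod] at huC2
    have hIccI : Icc 0 S ⊆ I := fun t ht =>
      ⟨ht.1, (EReal.coe_le_coe_iff.mpr ht.2).trans_lt hST⟩
    have hIint : Ioo 0 S ⊆ interior I :=
      interior_maximal (Ioo_subset_Icc_self.trans hIccI) isOpen_Ioo
    have hIord : I.OrdConnected := ⟨fun a ha b hb t ht =>
      ⟨ha.1.trans ht.1, (EReal.coe_le_coe_iff.mpr ht.2).trans_lt hb.2⟩⟩
    have huxc := continuousOn_partial_of_contDiffOn hIord ((nonempty_Ioo.mpr hS0).mono hIint) huC2
      fun t ht x => hux t x ht.1 ht.2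
    have hcurve : ContinuousOn (fun t => (t, q t x₀)) (Icc 0 S) :=
      continuousOn_id.prodMk fun t ht =>
        (hqt t x₀ (hIccI ht).1 (hIccI ht).2).continuousAt.continuousWithinAt
    have hmaps : MapsTo (fun t => (t, q t x₀)) (Icc 0 S) (I ×ˢ univ) := fun t ht =>
      ⟨hIccI ht, mem_univ _⟩
    have hvc : ContinuousOn (fun t => u t (q t x₀) + k) (Icc 0 S) :=
      (huC2.continuousOn.comp hcurve hmaps).add continuousOn_const
    have hwc : ContinuousOn (fun t => ux t (q t x₀)) (Icc 0 S) := huxc.comp hcurve hmaps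
    -- evolution of `u` and `ux` along the trajectory
    have hev : ∀ t ∈ Ioo 0 S, ∃ L R : ℝ,
        (u t (q t x₀) + k) ^ 2 / 4 ≤ L ∧ (u t (q t x₀) + k) ^ 2 / 4 ≤ R ∧
        HasDerivAt (fun s => u s (q s x₀) + k) ((L - R) / α) t ∧
        HasDerivAt (fun s => ux s (q s x₀))
          (-ux t (q t x₀) ^ 2 / 2 + ((u t (q t x₀) + k) ^ 2 - L - R) / α ^ 2) t := by
      intro t ht
      obtain ⟨ht0, htT⟩ := hIccI (Ioo_subset_Icc_self ht)
      have hΩ : IsOpen (Ioo 0 S ×ˢ (univ : Set ℝ)) := isOpen_Ioo.prod isOpen_univ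
      have hΩI : Ioo 0 S ×ˢ (univ : Set ℝ) ⊆ I ×ˢ univ :=
        prod_mono (Ioo_subset_Icc_self.trans hIccI) subset_rfl
      have hchain := fun x => hasDerivAt_partial_along_curve hΩ (huC2.mono hΩI) (ut := ut) (ux := ux)
        (fun p hp => hut p.1 p.2 (hΩI hp).1.1 (hΩI hp).1.2)
        (fun p hp => hux p.1 p.2 (hΩI hp).1.1 (hΩI hp).1.2) (t := t) (x := x) ⟨ht, mem_univ x⟩
      have huxt : Continuous (ux t) := continuous_iff_continuousAt.mpr fun x => by
        obtain ⟨a, -, ha, -⟩ := hchain x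
        exact ha.continuousAt
      obtain ⟨L, R, hL', hR', hL, hR, hP⟩ := exists_green_halves hα k
        (fun x => hux t x ht0 htT) huxt (hL2 t ht0 htT).1 (hL2 t ht0 htT).2
        (hdecay t ht0 htT).1 (hdecay t ht0 htT).2
      have hpde : ∀ x, ut t x = (L x - R x) / α - (u t x + lam) * ux t x := by
        intro x
        have h := hPDE t x ht0 htT
        rw [hP] at h
        linear_combination h
      obtain ⟨a, b, ha, hb, hcurve'⟩ := hchain (q t x₀)
      have hw := hcurve' (fun s => q s x₀) _ rfl (hqt t x₀ ht0 htT)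
      have hb' := (((hL' (q t x₀)).sub (hR' (q t x₀))).div_const α).sub
        (((hux t (q t x₀) ht0 htT).add_const lam).mul ha)
      have hbeq := (hb.congr_of_eventuallyEq (Eventually.of_forall fun x => (hpde x).symm)).unique hb'
      refine ⟨L (q t x₀) + k ^ 2 / 2, R (q t x₀) + k ^ 2 / 2, by linarith [hL (q t x₀)],
        by linarith [hR (q t x₀)], ?_, ?_⟩
      · have hU : HasFDerivAt (fun p : ℝ × ℝ => u p.1 p.2)
            (fderiv ℝ (fun p : ℝ × ℝ => u p.1 p.2) (t, q t x₀)) (t, q t x₀) :=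
          (((huC2.mono hΩI).contDiffAt (hΩ.mem_nhds ⟨ht, mem_univ _⟩)).differentiableAt
            (by norm_num)).hasFDerivAt
        set D := fderiv ℝ (fun p : ℝ × ℝ => u p.1 p.2) (t, q t x₀)
        have hDt : ut t (q t x₀) = D (1, 0) := (hut t (q t x₀) ht0 htT).unique <|
          HasFDerivAt.comp_hasDerivAt t (f := fun s => (s, q t x₀)) hU
            ((hasDerivAt_id t).prodMk (hasDerivAt_const t _))
        have hDx : ux t (q t x₀) = D (0, 1) := (hux t (q t x₀) ht0 htT).unique <|
          HasFDerivAt.comp_hasDerivAt (q t x₀) (f := fun y => (t, y)) hU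
            ((hasDerivAt_const _ t).prodMk (hasDerivAt_id _))
        have hD := HasFDerivAt.comp_hasDerivAt t (f := fun s => (s, q s x₀)) hU
          ((hasDerivAt_id t).prodMk (hqt t x₀ ht0 htT))
        refine (hD.add_const k).congr_deriv ?_
        have hv : ((1 : ℝ), u t (q t x₀) + lam) = (1, 0) + (u t (q t x₀) + lam) • (0, 1) := by simp
        rw [hv, map_add, map_smul, ← hDt, ← hDx, hpde, smul_eq_mul]
        ring
      · refine hw.congr_deriv ?_
        rw [hbeq]
        field_simp
        ring
    choose! L R hL hR hv' hw' using hev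
    have hpos : |u 0 x₀ + k| < -(α * ux 0 x₀) := by
      have h := mul_lt_mul_of_pos_left hx₀ hα
      have h2 : α * (-(1 / α) * |u 0 x₀ + k|) = -|u 0 x₀ + k| := by field_simp
      linarith
    have hlife := riccati_pair_lifespan_le (c := 1 / (2 * α)) (S := S) (by positivity) hS0
      (A := fun t => -(α * ux t (q t x₀)) - (u t (q t x₀) + k))
      (B := fun t => -(α * ux t (q t x₀)) + (u t (q t x₀) + k))
      ((hwc.const_mul α).neg.sub hvc) ((hwc.const_mul α).neg.add hvc)
      (fun t ht => ((hw' t ht).const_mul α).neg.sub (hv' t ht))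
      (fun t ht => ((hw' t ht).const_mul α).neg.add (hv' t ht))
      (fun t ht => by
        rw [← sub_nonneg]
        refine le_of_le_of_eq (div_nonneg (sub_nonneg.mpr (hR t ht)) hα.le |>.trans
          (le_mul_of_one_le_left (div_nonneg (sub_nonneg.mpr (hR t ht)) hα.le)
            (one_le_two (α := ℝ)))) ?_
        field_simp
        ring)
      (fun t ht => by
        rw [← sub_nonneg]
        refine le_of_le_of_eq (div_nonneg (sub_nonneg.mpr (hL t ht)) hα.le |>.trans
          (le_mul_of_one_le_left (div_nonneg (sub_nonneg.mpr (hL t ht)) hα.le)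
            (one_le_two (α := ℝ)))) ?_
        field_simp
        ring)
      (by simp only [hq0]; linarith [le_abs_self (u 0 x₀ + k)])
      (by simp only [hq0]; linarith [neg_abs_le (u 0 x₀ + k)])
    refine hlife.trans_eq ?_
    simp only [hq0]
    have hprod : (-(α * ux 0 x₀) - (u 0 x₀ + k)) * (-(α * ux 0 x₀) + (u 0 x₀ + k))
        = α ^ 2 * (ux 0 x₀ ^ 2 - (u 0 x₀ + k) ^ 2 / α ^ 2) := by
      field_simp
      ring
    rw [hprod, Real.sqrt_mul (sq_nonneg α), Real.sqrt_sq hα.le]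
    field_simp
  have hle : T ≤ ((2 / √(ux 0 x₀ ^ 2 - (u 0 x₀ + k) ^ 2 / α ^ 2) : ℝ) : EReal) := by
    by_contra! hlt
    obtain ⟨S, hS₁, hS₂⟩ := EReal.lt_iff_exists_real_btwn.mp hlt
    have hS₁' := EReal.coe_lt_coe_iff.mp hS₁
    exact absurd (hS S ((by positivity : (0 : ℝ) ≤ _).trans_lt hS₁') hS₂) (not_le.mpr hS₁')
  exact ⟨hle, hle.trans_lt (EReal.coe_lt_top _)⟩
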